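/- For every a ∈ ℝ, b ∈ ℝ, μ > 0, the Poincaré lift of the Josephson equation satisfies the symmetry P̃_{a,b,μ}( −P̃_{a,b,μ}(y) ) = −y for all y ∈ ℝ. Equivalently, the Poincaré map P of the Josephson equation on the circle ℝ/2πℤ satisfies −P(−x) = P^{−1}(x). -/

import Mathlib

open Real

/-- `x` is a (global) solution of the Josephson equation `dx/dt = (cos x + a + b cos t)/μ`. -/
def IsJosephsonSol (a b μ : ℝ) (x : ℝ → ℝ) : Prop :=
  ∀ t : ℝ, HasDerivAt x ((Real.cos (x t) + a + b * Real.cos t) / μ) t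

/-- `P` is the Poincaré lift of the Josephson equation. -/
def IsPoincareLift (a b μ : ℝ) (P : ℝ → ℝ) : Prop :=
  ∀ x₀ : ℝ, ∃ x : ℝ → ℝ, IsJosephsonSol a b μ x ∧ x 0 = x₀ ∧ P x₀ = x (2 * π)

/-- The Josephson vector field is Lipschitz in the phase variable, uniformly in time. -/
theorem josephson_field_lipschitz (a b μ t : ℝ) :
    LipschitzWith ‖μ⁻¹‖₊ (fun x : ℝ => (Real.cos x + a + b * Real.cos t) / μ) := by
  refine LipschitzWith.of_dist_le_mul fun x y => ?_
  have h : |Real.cos x - Real.cos y| ≤ |x - y| := Real.abs_cos_sub_cos_le x y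
  rw [Real.dist_eq, Real.dist_eq,
    show (Real.cos x + a + b * Real.cos t) / μ - (Real.cos y + a + b * Real.cos t) / μ
      = μ⁻¹ * (Real.cos x - Real.cos y) by ring, abs_mul, coe_nnnorm, Real.norm_eq_abs]
  gcongr

/-- Solutions of the Josephson equation are determined by their initial value. -/
theorem IsJosephsonSol.eq_of_eq_zero {a b μ : ℝ} {x y : ℝ → ℝ} (hx : IsJosephsonSol a b μ x)
    (hy : IsJosephsonSol a b μ y) (h : x 0 = y 0) : x = y :=
  ODE_solution_unique_univ (s := fun _ => Set.univ)
    (fun t => (josephson_field_lipschitz a b μ t).lipschitzOnWith)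
    (fun t => ⟨hx t, Set.mem_univ _⟩) (fun t => ⟨hy t, Set.mem_univ _⟩) h

/-- The reversal `t ↦ -x (2π - t)` of a solution is a solution. -/
theorem IsJosephsonSol.reverse {a b μ : ℝ} {x : ℝ → ℝ} (hx : IsJosephsonSol a b μ x) :
    IsJosephsonSol a b μ (fun t => -x (2 * π - t)) := by
  intro t
  have h := ((hx (2 * π - t)).comp_const_sub (2 * π) t).neg
  simp only [neg_neg, Real.cos_two_pi_sub] at h
  simp only [Real.cos_neg]
  exact h

/-- The symmetry `(x, t) ↦ (-x, -t)` of the Josephson equation yields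
`P̃(-P̃(y)) = -y` for the Poincaré lift, i.e. `-P(-x) = P⁻¹(x)` for the Poincaré map. -/
theorem poincare_lift_symmetry
    (a b μ : ℝ) (hμ : 0 < μ) (P : ℝ → ℝ) (hP : IsPoincareLift a b μ P) :
    ∀ y : ℝ, P (-(P y)) = -y := by
  intro y
  obtain ⟨x, hx, hx0, hxP⟩ := hP y
  obtain ⟨z, hz, hz0, hzP⟩ := hP (-(P y))
  have h : z = fun t => -x (2 * π - t) :=
    hz.eq_of_eq_zero hx.reverse (by simp [hz0, hxP])
  simp [hzP, h, hx0]
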